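/- arXiv:1811.02555 — 2 statements merged into one kernel-verified Lean document; each statement's English description precedes it below -/
import Mathlib

section
/- Let Λ : H_n(ℂ) → H_n(ℂ) be an invertible ℝ-linear map on the real vector space of n×n Hermitian matrices that preserves the rank of every Hermitian matrix. Then there exist ε ∈ {−1,+1} and an invertible complex matrix X such that either Λ(A) = ε X A X† for all A, or Λ(A) = ε X Aᵀ X† for all A. -/
open Matrix

namespace RankPres
variable {n : ℕ}

abbrev Mat (n : ℕ) := Matrix (Fin n) (Fin n) ℂ

def out (v : Fin n → ℂ) : Mat n := fun i j => v i * star (v j)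

def Hm (i j : Fin n) (z : ℂ) : Mat n := fun k l =>
  (if k = i ∧ l = j then z else 0) + (if k = j ∧ l = i then star z else 0)

def Em (i : Fin n) : Mat n := fun k l => if k = i ∧ l = i then 1 else 0

lemma out_herm (v : Fin n → ℂ) : (out v).IsHermitian := by
  ext i j; simp [out, mul_comm]

lemma Hm_herm (i j : Fin n) (z : ℂ) : (Hm i j z).IsHermitian := by
  ext k l
  simp only [Hm, conjTranspose_apply, star_add]
  rw [add_comm]
  congr 1 <;> split_ifs <;> simp_all

lemma Em_herm (i : Fin n) : (Em i).IsHermitian := by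
  ext k l
  simp only [Em, conjTranspose_apply]
  split_ifs <;> simp_all

lemma smul_herm (r : ℝ) {A : Mat n} (hA : A.IsHermitian) : (r • A).IsHermitian := by
  ext i j
  have := hA.apply i j
  simp only [conjTranspose_apply, Matrix.smul_apply, Complex.real_smul, star_mul', this]
  simp

lemma sum_herm {ι : Type*} (s : Finset ι) (f : ι → Mat n) (hf : ∀ i, (f i).IsHermitian) :
    (∑ i ∈ s, f i).IsHermitian := by
  classical
  induction s using Finset.induction_on with
  | empty => simp
  | insert a s ha ih => rw [Finset.sum_insert ha]; exact (hf a).add ih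

structure Lin (Λ : Mat n → Mat n) : Prop where
  herm : ∀ A : Mat n, A.IsHermitian → (Λ A).IsHermitian
  add : ∀ A B : Mat n, A.IsHermitian → B.IsHermitian → Λ (A + B) = Λ A + Λ B
  smul : ∀ (r : ℝ) (A : Mat n), A.IsHermitian → Λ (r • A) = r • Λ A

lemma Lin.zero {Λ : Mat n → Mat n} (h : Lin Λ) : Λ 0 = 0 := by
  have := h.smul 0 0 (by simp)
  simpa using this

lemma Lin.sum {Λ : Mat n → Mat n} (h : Lin Λ) {ι : Type*} (s : Finset ι) (f : ι → Mat n)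
    (hf : ∀ i, (f i).IsHermitian) : Λ (∑ i ∈ s, f i) = ∑ i ∈ s, Λ (f i) := by
  classical
  induction s using Finset.induction_on with
  | empty => simpa using h.zero
  | insert a s ha ih =>
    rw [Finset.sum_insert ha, Finset.sum_insert ha, h.add _ _ (hf a) (sum_herm s f hf), ih]

lemma Hm_comm (i j : Fin n) (z : ℂ) : Hm j i (star z) = Hm i j z := by
  ext k l; simp only [Hm, star_star]; rw [add_comm]

lemma Hm_add (i j : Fin n) (z w : ℂ) : Hm i j (z + w) = Hm i j z + Hm i j w := by
  ext k l; simp only [Hm, star_add, Matrix.add_apply]; split_ifs <;> ring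

lemma Hm_smul (i j : Fin n) (r : ℝ) (w : ℂ) : Hm i j (r * w) = r • Hm i j w := by
  ext k l
  simp only [Hm, star_mul', Matrix.smul_apply, Complex.real_smul, Complex.star_def, Complex.conj_ofReal]
  split_ifs <;> ring

lemma Hm_diag (i : Fin n) (z : ℂ) : Hm i i z = (2 * z.re : ℝ) • Em i := by
  ext k l
  simp only [Hm, Em, Matrix.smul_apply, Complex.real_smul]
  split_ifs
  · simp [Complex.add_conj]
  · simp

lemma sum_Hm (F : Fin n → Fin n → ℂ) (k l : Fin n) :
    (∑ i, ∑ j, Hm i j (F i j)) k l = F k l + star (F l k) := by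
  simp only [Matrix.sum_apply, Hm, Finset.sum_add_distrib, ite_and]
  simp

lemma herm_decomp {A : Mat n} (hA : A.IsHermitian) : (2:ℝ) • A = ∑ i, ∑ j, Hm i j (A i j) := by
  ext k l
  rw [sum_Hm (fun i j => A i j), hA.apply]
  simp [two_mul]

lemma out_pair {i j : Fin n} (hij : i ≠ j) (z : ℂ) (t : ℝ) :
    out (fun k => if k = i then z else if k = j then (t : ℂ) else 0) =
      (Complex.normSq z) • Em i + (t^2) • Em j + t • Hm i j z := by
  ext k l
  simp only [out, Em, Hm, Matrix.add_apply, Matrix.smul_apply, Complex.real_smul]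
  by_cases h1 : k = i <;> by_cases h2 : l = i <;> by_cases h3 : k = j <;> by_cases h4 : l = j <;>
    simp_all [Complex.mul_conj, mul_comm, pow_two]

lemma zero_of_lin {c a : ℝ} (h : ∀ t : ℝ, 0 ≤ c + t * a) : a = 0 := by
  by_contra ha
  have := h (-(c+1)/a)
  rw [div_mul_cancel₀ _ ha] at this
  linarith

lemma zero_of_quad {a : ℝ} (h : ∀ t : ℝ, 0 ≤ t^2 + t * a) : a = 0 := by
  have := h (-a/2)
  nlinarith [sq_nonneg a]

lemma Hm_image {Λ : Mat n → Mat n} (h : Lin Λ) (hout : ∀ v, ∃ w, Λ (out v) = out w)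
    (hE : ∀ i, Λ (Em i) = Em i) {i j : Fin n} (hij : i ≠ j) (z : ℂ) :
    Λ (Hm i j z) = Hm i j (Λ (Hm i j z) i j) := by
  set N := Λ (Hm i j z) with hN
  have hNh : N.IsHermitian := h.herm _ (Hm_herm i j z)
  have key : ∀ t : ℝ, ∃ w : Fin n → ℂ, 
      (Complex.normSq z) • Em i + (t^2) • Em j + t • N = out w := by
    intro t
    obtain ⟨w, hw⟩ := hout (fun k => if k = i then z else if k = j then (t : ℂ) else 0)
    refine ⟨w, ?_⟩
    rw [← hw, out_pair hij, h.add _ _ ((smul_herm _ (Em_herm i)).add (smul_herm _ (Em_herm j)))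
      (smul_herm _ (Hm_herm i j z)), h.add _ _ (smul_herm _ (Em_herm i)) (smul_herm _ (Em_herm j)),
      h.smul _ _ (Em_herm i), h.smul _ _ (Em_herm j), h.smul _ _ (Hm_herm i j z), hE, hE]
  have outre : ∀ (w : Fin n → ℂ) k, (out w k k).re = Complex.normSq (w k) := by
    intro w k; simp [out, Complex.mul_conj]
  have hre : ∀ k, (N k k).re = 0 := by
    intro k
    have hk : ∀ t : ℝ, 0 ≤ ((Complex.normSq z) • Em i k k + (t^2) • Em j k k + t • N k k).re := by
      intro t
      obtain ⟨w, hw⟩ := key t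
      have := congrArg (fun M : Mat n => (M k k).re) hw
      simp only [outre, Matrix.add_apply, Matrix.smul_apply] at this
      rw [this]; exact Complex.normSq_nonneg _
    by_cases hki : k = i
    · subst hki
      apply zero_of_lin (c := Complex.normSq z)
      intro t; simpa [Em, hij] using hk t
    · by_cases hkj : k = j
      · subst hkj
        apply zero_of_quad
        intro t; simpa [Em, hki, ← Complex.ofReal_pow] using hk t
      · apply zero_of_lin (c := 0)
        intro t; simpa [Em, hki, hkj] using hk t
  have hdiag : ∀ k, N k k = 0 := by
    intro k
    apply Complex.ext
    · simpa using hre k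
    · have := congrArg Complex.im (hNh.apply k k)
      simp at this ⊢; linarith
  have hrow : ∀ k l, k ≠ i → k ≠ j → N k l = 0 := by
    intro k l hki hkj
    obtain ⟨w, hw⟩ := key 1
    have h1 := congrFun (congrFun hw k) k
    have h2 := congrFun (congrFun hw k) l
    simp [Em, hki, hkj, hdiag, out] at h1 h2
    rw [h2, h1, zero_mul]
  ext k l
  simp only [Hm]
  by_cases hki : k = i
  · subst hki
    by_cases hlj : l = j
    · subst hlj; simp [hij]
    · by_cases hlk : l = k
      · subst hlk; simp [hij, hdiag]
      · have := hrow l k hlk hlj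
        rw [← hNh.apply, this]; simp [hlj, hlk]
  · by_cases hkj : k = j
    · subst hkj
      by_cases hli : l = i
      · subst hli; simp [hki, hNh.apply]
      · by_cases hlk : l = k
        · subst hlk; simp [hdiag, hki]
        · have := hrow l k hli hlk
          rw [← hNh.apply, this]; simp [hli, hlk]
    · rw [hrow k l hki hkj]; simp [hki, hkj]

lemma phi_exists {Λ : Mat n → Mat n} (h : Lin Λ) (hout : ∀ v, ∃ w, Λ (out v) = out w)
    (hE : ∀ i, Λ (Em i) = Em i) : ∃ φ : Fin n → Fin n → ℂ → ℂ,
      (∀ i j a b, φ i j (a + b) = φ i j a + φ i j b) ∧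
      (∀ i j (r : ℝ) a, φ i j (r * a) = r * φ i j a) ∧
      (∀ i j a, φ j i (star a) = star (φ i j a)) ∧
      (∀ i a, φ i i a = a) ∧
      ∀ A : Mat n, A.IsHermitian → ∀ i j, Λ A i j = φ i j (A i j) := by
  set φ : Fin n → Fin n → ℂ → ℂ := fun i j z => if i = j then z else Λ (Hm i j z) i j with hφ
  have hstar : ∀ i j a, φ j i (star a) = star (φ i j a) := by
    intro i j a
    simp only [hφ]
    by_cases hij : i = j
    · simp [hij]
    · rw [if_neg hij, if_neg (Ne.symm hij), Hm_comm]
      exact ((h.herm _ (Hm_herm i j a)).apply j i).symm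
  refine ⟨φ, ?_, ?_, hstar, ?_, ?_⟩
  · intro i j a b
    simp only [hφ]
    by_cases hij : i = j
    · simp [hij]
    · simp only [if_neg hij]
      rw [Hm_add, h.add _ _ (Hm_herm _ _ _) (Hm_herm _ _ _)]; rfl
  · intro i j r b
    simp only [hφ]
    by_cases hij : i = j
    · simp [hij]
    · simp only [if_neg hij]
      rw [Hm_smul, h.smul _ _ (Hm_herm _ _ _)]; simp
  · intro i a; simp [hφ]
  · intro A hA k l
    have h1 : (2:ℝ) • Λ A = ∑ i, ∑ j, Hm i j (φ i j (A i j)) := by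
      rw [← h.smul _ _ hA, herm_decomp hA, h.sum Finset.univ (fun i => ∑ j, Hm i j (A i j)) (fun i => sum_herm _ _ (fun j => Hm_herm _ _ _))]
      refine Finset.sum_congr rfl fun i _ => ?_
      rw [h.sum Finset.univ (fun j => Hm i j (A i j)) (fun j => Hm_herm _ _ _)]
      refine Finset.sum_congr rfl fun j _ => ?_
      by_cases hij : i = j
      · subst hij
        simp only [hφ, if_true]
        rw [Hm_diag, h.smul _ _ (Em_herm i), hE]
      · simp only [hφ, if_neg hij]
        exact Hm_image h hout hE hij _
    have h2 := congrFun (congrFun h1 k) l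
    rw [sum_Hm (fun i j => φ i j (A i j)), ← hA.apply l k, hstar, star_star] at h2
    simp only [Matrix.smul_apply, Complex.real_smul] at h2
    push_cast at h2
    linear_combination h2 / 2

lemma isom_cases {u w : ℂ} (hu : Complex.normSq u = 1) (hw : Complex.normSq w = 1)
    (huw : Complex.normSq (u + w) = 2) : w = Complex.I * u ∨ w = - Complex.I * u := by
  have hre : (u * star w + w * star u) = 0 := by
    have e : ((Complex.normSq (u+w) : ℝ) : ℂ) = (Complex.normSq u : ℝ) + (Complex.normSq w : ℝ) + (u * star w + w * star u) := by
      rw [← Complex.mul_conj, ← Complex.mul_conj, ← Complex.mul_conj]; simp; ring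
    rw [hu, hw, huw] at e
    push_cast at e
    linear_combination -e
  have eu : u * star u = 1 := by simpa [hu] using Complex.mul_conj u
  have ew : w * star w = 1 := by simpa [hw] using Complex.mul_conj w
  have : (w - Complex.I * u) * (w + Complex.I * u) = 0 := by
    have hI := Complex.I_mul_I
    linear_combination (-u*u)*hI + u*w*hre - u*u*ew - w*w*eu
  rcases mul_eq_zero.1 this with h | h
  · left; linear_combination h
  · right; linear_combination h

lemma core (hn : 0 < n) {Λ : Mat n → Mat n} (h : Lin Λ) (hout : ∀ v, ∃ w, Λ (out v) = out w)
    (hE : ∀ i, Λ (Em i) = Em i) : ∃ d : Fin n → ℂ, (∀ i, d i * star (d i) = 1) ∧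
      ((∀ A : Mat n, A.IsHermitian → ∀ i j, Λ A i j = d i * A i j * star (d j)) ∨
       (∀ A : Mat n, A.IsHermitian → ∀ i j, Λ A i j = d i * A j i * star (d j))) := by
  obtain ⟨φ, hadd, hmul, hstar, hid, hφ⟩ := phi_exists h hout hE
  set o : Fin n := ⟨0, hn⟩
  have key : ∀ v : Fin n → ℂ, v o = 1 → ∀ i k,
      φ i k (v i * star (v k)) = φ i o (v i) * star (φ k o (v k)) := by
    intro v hv i k
    obtain ⟨w, hw⟩ := hout v
    have e : ∀ i j, φ i j (v i * star (v j)) = w i * star (w j) := by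
      intro i j
      have := hφ _ (out_herm v) i j
      rw [hw] at this; exact this.symm
    have e0 := e o o
    have e1 := e i o
    have e2 := e k o
    rw [hid, hv] at e0
    rw [hv, star_one, mul_one] at e1 e2
    rw [e i k, e1, e2]
    simp only [star_one, mul_one, star_mul', star_star] at e0 ⊢
    linear_combination (w i * star (w k)) * e0
  have hns : ∀ i, i ≠ o → ∀ z, φ i o z * star (φ i o z) = z * star z := by
    intro i hi z
    have := key (fun k => if k = o then 1 else z) (by simp) i i
    simp only [if_neg hi, hid] at this
    exact this.symm
  have hnq : ∀ i, i ≠ o → ∀ z, Complex.normSq (φ i o z) = Complex.normSq z := by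
    intro i hi z
    have := hns i hi z
    simp only [Complex.star_def, Complex.mul_conj] at this
    exact_mod_cast this
  set d : Fin n → ℂ := fun i => φ i o 1 with hd
  have hdo : d o = 1 := by simp [hd, hid]
  have hd1 : ∀ i, d i * star (d i) = 1 := by
    intro i
    by_cases hi : i = o
    · subst hi; simp [hdo]
    · simp only [hd, hns i hi, star_one, mul_one]
  have hI : ∀ i, i ≠ o → φ i o Complex.I = Complex.I * d i ∨ φ i o Complex.I = - Complex.I * d i := by
    intro i hi
    apply isom_cases
    · simp [hd, hnq i hi]
    · simp [hnq i hi]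
    · rw [hd, ← hadd, hnq i hi]; simp [Complex.normSq_apply]; norm_num
  have hz : ∀ i z, φ i o z = z.re * d i + z.im * φ i o Complex.I := by
    intro i z
    conv_lhs => rw [← Complex.re_add_im z, hadd, hmul]
    rw [← mul_one (z.re : ℂ), hmul, mul_one]
  have hcons : ∀ i k, i ≠ o → k ≠ o → φ i o Complex.I = Complex.I * d i →
      φ k o Complex.I = - Complex.I * d k → False := by
    intro i k hi hk h1 h2
    have e1 := key (fun m => if m = o then 1 else Complex.I) (by simp) i k
    have e2 := key (fun m => 1) (by simp) i k
    simp only [if_neg hi, if_neg hk, h1, h2] at e1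
    have e3 : Complex.I * star Complex.I = 1 * star 1 := by simp
    rw [e3, e2] at e1
    have e4 := hd1 i
    have e5 := hd1 k
    have e6 := Complex.I_mul_I
    simp only [star_mul', star_neg, Complex.star_def, Complex.conj_I] at *
    have : (2 : ℂ) = 0 := by
      have e7 : d i * star (d k) = - (d i * star (d k)) := by
        simp only [Complex.star_def]
        linear_combination e1 + (d i * (starRingEnd ℂ) (d k)) * e6
      have e8 : d i * star (d k) = 0 := by linear_combination e7 / 2
      have hi0 : d i ≠ 0 := by intro h0; simp [h0] at e4
      have hk0 : d k ≠ 0 := by intro h0; simp [h0] at e5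
      simp [hi0, hk0] at e8
    norm_num at this
  have hik : ∀ i k z, i ≠ k → i ≠ o → φ i k z = φ i o z * star (d k) := by
    intro i k z hik hi
    have := key (fun m => if m = i then z else 1) (by simp [Ne.symm hi]) i k
    simpa [Ne.symm hik] using this
  refine ⟨d, hd1, ?_⟩
  by_cases hall : ∀ i, i ≠ o → φ i o Complex.I = Complex.I * d i
  · left
    intro A hA i j
    rw [hφ A hA]
    have hlin : ∀ i, i ≠ o → ∀ z, φ i o z = d i * z := by
      intro i hi z
      rw [hz, hall i hi]
      conv_rhs => rw [← Complex.re_add_im z]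
      ring
    by_cases hij : i = j
    · subst hij
      rw [hid]; linear_combination (- A i i) * hd1 i
    · by_cases hi : i = o
      · have hj : j ≠ o := fun hj => hij (hi.trans hj.symm)
        have := hstar j i (star (A i j))
        rw [star_star] at this
        rw [this, hi, hlin j hj, hdo]
        simp [mul_comm]
      · rw [hik i j _ hij hi, hlin i hi]
  · right
    push Not at hall
    obtain ⟨i0, hi0, hi0'⟩ := hall
    have hneg := (hI i0 hi0).resolve_left hi0'
    intro A hA i j
    rw [hφ A hA]
    have hlin : ∀ i, i ≠ o → ∀ z, φ i o z = d i * star z := by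
      intro i hi z
      have : φ i o Complex.I = - Complex.I * d i :=
        (hI i hi).resolve_left (fun hh => hcons i i0 hi hi0 hh hneg)
      rw [hz, this]
      have : star z = z.re - z.im * Complex.I := by
        apply Complex.ext <;> simp
      rw [this]; ring
    by_cases hij : i = j
    · subst hij
      rw [hid]; linear_combination (- A i i) * hd1 i
    · by_cases hi : i = o
      · have hj : j ≠ o := fun hj => hij (hi.trans hj.symm)
        have := hstar j i (star (A i j))
        rw [star_star] at this
        rw [this, hi, hlin j hj, hdo, ← hA.apply j o]
        simp [mul_comm]
      · rw [hik i j _ hij hi, hlin i hi, hA.apply]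

lemma rank_one_form {M : Mat n} (hM : M.IsHermitian) (hr : M.rank = 1) :
    ∃ w : Fin n → ℂ, w ≠ 0 ∧ (M = out w ∨ M = (-1 : ℝ) • out w) := by
  rw [hM.rank_eq_card_non_zero_eigs, Fintype.card_eq_one_iff] at hr
  obtain ⟨⟨i, hi⟩, hu⟩ := hr
  set U : Mat n := (hM.eigenvectorUnitary : Matrix (Fin n) (Fin n) ℂ) with hU
  have hs : ∀ k l, M k l = hM.eigenvalues i * (U k i * star (U l i)) := by
    intro k l
    have := hM.spectral_theorem
    rw [Unitary.conjStarAlgAut_apply] at this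
    have := congrFun (congrFun this k) l
    rw [this, Matrix.mul_apply, Finset.sum_eq_single i]
    · simp [Matrix.mul_diagonal, hU, Matrix.star_apply]; ring
    · intro b _ hb
      have : hM.eigenvalues b = 0 := by
        by_contra h0
        exact hb (congrArg Subtype.val (hu ⟨b, h0⟩))
      simp [Matrix.mul_diagonal, this]
    · simp
  have hM0 : M ≠ 0 := by
    intro h0
    have := hM.rank_eq_card_non_zero_eigs
    have hc : Fintype.card {i // hM.eigenvalues i ≠ 0} = 1 := 
      Fintype.card_eq_one_iff.2 ⟨⟨i, hi⟩, hu⟩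
    rw [hc] at this
    rw [h0] at this; simp at this
  set c := hM.eigenvalues i with hc
  have hsq : (Real.sqrt |c| : ℂ) * (Real.sqrt |c| : ℂ) = (|c| : ℝ) := by
    rw [← Complex.ofReal_mul, Real.mul_self_sqrt (abs_nonneg c)]
  have hor : M = out (fun k => Real.sqrt |c| * U k i) ∨
      M = (-1 : ℝ) • out (fun k => Real.sqrt |c| * U k i) := by
    rcases lt_or_gt_of_ne hi with hneg | hpos
    · right
      ext k l
      rw [hs]
      rw [abs_of_neg hneg] at hsq ⊢
      simp [out] at hsq ⊢
      linear_combination (U k i * (starRingEnd ℂ) (U l i)) * hsq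
    · left
      ext k l
      rw [hs]
      rw [abs_of_pos hpos] at hsq ⊢
      simp [out] at hsq ⊢
      linear_combination (-(U k i * (starRingEnd ℂ) (U l i))) * hsq
  refine ⟨_, ?_, hor⟩
  intro h0
  rw [h0] at hor
  apply hM0
  rcases hor with h | h <;> rw [h] <;> ext <;> simp [out]

lemma out_rank {v : Fin n → ℂ} (hv : v ≠ 0) : (out v).rank = 1 := by
  have e : out v = vecMulVec v (star v) := by ext i j; simp [out, vecMulVec_apply]
  apply le_antisymm
  · rw [e]; exact rank_vecMulVec_le _ _
  · rw [Nat.one_le_iff_ne_zero]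
    intro h0
    have h1 := (out_herm v).rank_eq_card_non_zero_eigs
    rw [h0, eq_comm, Fintype.card_eq_zero_iff] at h1
    have h2 : (out_herm v).eigenvalues = 0 := by
      ext i
      by_contra hne
      exact h1.false ⟨i, hne⟩
    rw [Matrix.IsHermitian.eigenvalues_eq_zero_iff] at h2
    apply hv
    ext i
    have := congrFun (congrFun h2 i) i
    simpa [out] using this

lemma out_trace_pos {w : Fin n → ℂ} (hw : w ≠ 0) : 0 < (trace (out w)).re := by
  have : (trace (out w)).re = ∑ i, Complex.normSq (w i) := by
    simp [trace, out, Complex.mul_conj]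
  rw [this]
  obtain ⟨i, hi⟩ := Function.ne_iff.1 hw
  exact Finset.sum_pos' (fun _ _ => Complex.normSq_nonneg _)
    ⟨i, Finset.mem_univ _, Complex.normSq_pos.2 hi⟩

def cross (v w : Fin n → ℂ) : Mat n := fun i j => v i * star (w j) + w i * star (v j)

lemma cross_herm (v w : Fin n → ℂ) : (cross v w).IsHermitian := by
  ext i j; simp [cross]; ring

lemma out_line (v w : Fin n → ℂ) (t s : ℝ) : out (fun i => t * v i + s * w i) =
    (t^2) • out v + (s^2) • out w + (t * s) • cross v w := by
  ext i j; simp [out, cross]; ring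

lemma trace_no_mix {Λ : Mat n → Mat n} (h : Lin Λ)
    (h1 : ∀ v : Fin n → ℂ, v ≠ 0 → (trace (Λ (out v))).re ≠ 0) (v w : Fin n → ℂ)
    (hv : 0 < (trace (Λ (out v))).re) (hw : (trace (Λ (out w))).re < 0) : False := by
  have hq : ∀ t s : ℝ, (trace (Λ (out (fun i => t * v i + s * w i)))).re =
      t^2 * (trace (Λ (out v))).re + s^2 * (trace (Λ (out w))).re
        + (t*s) * (trace (Λ (cross v w))).re := by
    intro t s
    rw [out_line, h.add _ _ ((smul_herm _ (out_herm v)).add (smul_herm _ (out_herm w)))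
      (smul_herm _ (cross_herm v w)), h.add _ _ (smul_herm _ (out_herm v)) (smul_herm _ (out_herm w)),
      h.smul _ _ (out_herm v), h.smul _ _ (out_herm w), h.smul _ _ (cross_herm v w)]
    simp only [trace_add, trace_smul, Complex.add_re, Complex.smul_re, smul_eq_mul]
  set f : ℝ → ℝ := fun t => t^2 * (trace (Λ (out v))).re + (1-t)^2 * (trace (Λ (out w))).re
        + (t*(1-t)) * (trace (Λ (cross v w))).re with hf
  have hc : Continuous f := by fun_prop
  have h0 : f 0 < 0 := by simpa [hf] using hw
  have h1' : 0 < f 1 := by simpa [hf] using hv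
  obtain ⟨t, ht, ht0⟩ := intermediate_value_Icc (zero_le_one) hc.continuousOn ⟨h0.le, h1'.le⟩
  have hu : (fun i => (t:ℂ) * v i + ((1 - t : ℝ) : ℂ) * w i) = 0 := by
    by_contra hne
    exact h1 _ hne ((hq t (1-t)).trans ht0)
  have ht1 : t ≠ 0 := by rintro rfl; exact h0.ne ht0
  have heq : (t^2) • out v = ((1-t)^2) • out w := by
    ext i j
    have e : ∀ i, (t:ℂ) * v i = - ((1 - t) * w i) := by
      intro i
      have := congrFun hu i
      simp at this
      linear_combination this
    have e1 := e i
    have e2 := congrArg (starRingEnd ℂ) (e j)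
    simp at e2
    simp [out]
    linear_combination (t * (starRingEnd ℂ) (v j)) * e1 - ((1 - t) * w i) * e2
  have e := congrArg (fun M => (trace (Λ M)).re) heq
  simp only [h.smul _ _ (out_herm _), trace_smul, Complex.smul_re, smul_eq_mul] at e
  have : 0 < t^2 := by positivity
  nlinarith [mul_pos this hv, mul_nonneg (sq_nonneg (1-t)) (neg_nonneg.2 hw.le)]

lemma isUnit_of_rank {X : Mat n} (h : X.rank = n) : IsUnit X := by
  rw [← Matrix.mulVec_surjective_iff_isUnit]
  have : LinearMap.range X.mulVecLin = ⊤ := by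
    apply Submodule.eq_top_of_finrank_eq
    simpa [Matrix.rank] using h
  exact LinearMap.range_eq_top.1 this

lemma sum_Em : ∑ i : Fin n, Em i = (1 : Mat n) := by
  ext k l
  simp only [Matrix.sum_apply, Em, ite_and, Matrix.one_apply]
  simp [eq_comm]

lemma Em_out (i : Fin n) : Em i = out (Pi.single i 1) := by
  ext k l
  simp only [Em, out, Pi.single_apply]
  split_ifs <;> simp_all

lemma out_conj (Y : Mat n) (w : Fin n → ℂ) : Y * out w * Yᴴ = out (Y *ᵥ w) := by
  have e : ∀ v : Fin n → ℂ, out v = vecMulVec v (star v) := by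
    intro v; ext i j; simp [out, vecMulVec_apply]
  rw [e, e, mul_vecMulVec, vecMulVec_mul, star_mulVec]

/-- The positive case: rank-one projections go to positive rank-one matrices. -/
lemma pos_case (hn : 0 < n) {Λ : Mat n → Mat n} (h : Lin Λ) (hout : ∀ v, ∃ w, Λ (out v) = out w)
    (hrank : (Λ 1).rank = n) : ∃ X : Mat n, IsUnit X ∧
      ((∀ A : Mat n, A.IsHermitian → Λ A = X * A * Xᴴ) ∨
       (∀ A : Mat n, A.IsHermitian → Λ A = X * Aᵀ * Xᴴ)) := by
  choose x hx using fun i : Fin n => hout (Pi.single i 1)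
  set X : Mat n := Matrix.of fun k i => x i k with hX
  have hXE : ∀ i, Λ (Em i) = X * Em i * Xᴴ := by
    intro i
    rw [Em_out, hx, out_conj]
    congr 1
    ext k; simp [hX]
  have hX1 : Λ 1 = X * Xᴴ := by
    rw [← sum_Em, h.sum _ _ Em_herm]
    simp only [hXE]
    rw [← Finset.sum_mul, ← Finset.mul_sum, sum_Em, mul_one]
  have hXu : IsUnit X := by
    apply isUnit_of_rank
    have hle := rank_mul_le_left X Xᴴ
    rw [← hX1, hrank] at hle
    exact le_antisymm (by simpa using rank_le_width X) hle
  obtain ⟨Y, hXY, hYX⟩ : ∃ Y : Mat n, X * Y = 1 ∧ Y * X = 1 := by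
    obtain ⟨u, hu⟩ := hXu
    exact ⟨(u⁻¹ : (Mat n)ˣ), by rw [← hu]; simp, by rw [← hu]; simp⟩
  have hXYh : Yᴴ * Xᴴ = 1 := by rw [← conjTranspose_mul, hXY]; simp
  have hYXh : Xᴴ * Yᴴ = 1 := by rw [← conjTranspose_mul, hYX]; simp
  have hL : Lin (fun A => Y * Λ A * Yᴴ) := by
    refine ⟨?_, ?_, ?_⟩
    · intro A hA
      exact isHermitian_mul_mul_conjTranspose _ (h.herm A hA)
    · intro A B hA hB
      simp only [h.add A B hA hB, mul_add, add_mul]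
    · intro r A hA
      simp only [h.smul r A hA, mul_smul_comm, smul_mul_assoc]
  obtain ⟨d, hd, hcase⟩ := core hn hL
    (by
      intro v
      obtain ⟨w, hw⟩ := hout v
      exact ⟨Y *ᵥ w, by simp only [hw, out_conj]⟩)
    (by
      intro i
      simp only [hXE]
      calc Y * (X * Em i * Xᴴ) * Yᴴ = (Y * X) * Em i * (Xᴴ * Yᴴ) := by simp only [mul_assoc]
        _ = Em i := by rw [hYX, hYXh, one_mul, mul_one])
  have hback : ∀ A B : Mat n, (∀ i j, (Y * Λ A * Yᴴ) i j = d i * B i j * star (d j)) →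
      Λ A = (X * diagonal d) * B * (X * diagonal d)ᴴ := by
    intro A B hAB
    have e : Y * Λ A * Yᴴ = diagonal d * B * (diagonal d)ᴴ := by
      ext i j
      rw [hAB, diagonal_conjTranspose, mul_diagonal, diagonal_mul]; rfl
    calc Λ A = (X * Y) * Λ A * (Yᴴ * Xᴴ) := by rw [hXY, hXYh, one_mul, mul_one]
      _ = X * (Y * Λ A * Yᴴ) * Xᴴ := by simp only [mul_assoc]
      _ = _ := by rw [e, conjTranspose_mul]; simp only [mul_assoc]
  refine ⟨X * diagonal d, ?_, ?_⟩
  · apply hXu.mul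
    have : diagonal d * diagonal (star d) = 1 := by
      rw [diagonal_mul_diagonal, ← diagonal_one]
      congr 1; ext i; exact hd i
    exact IsUnit.of_mul_eq_one _ this
  · rcases hcase with hc | hc
    · left; intro A hA; exact hback A A (hc A hA)
    · right; intro A hA; exact hback A Aᵀ (hc A hA)

end RankPres

/-- Loewy's structure theorem: An invertible ℝ-linear,
rank-preserving map `Λ` on the real vector space of `n×n` Hermitian matrices is of
the form `Λ(A) = ε X A X†` or `Λ(A) = ε X Aᵀ X†` for some sign `ε ∈ {−1,+1}` and
invertible `X`. -/
theorem rank_preserving_maps_on_hermitian_matrices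
    (n : ℕ) (hn : 0 < n)
    (Λ : Matrix (Fin n) (Fin n) ℂ → Matrix (Fin n) (Fin n) ℂ)
    (hherm : ∀ A : Matrix (Fin n) (Fin n) ℂ, A.IsHermitian → (Λ A).IsHermitian)
    (hadd : ∀ A B : Matrix (Fin n) (Fin n) ℂ, A.IsHermitian → B.IsHermitian →
      Λ (A + B) = Λ A + Λ B)
    (hsmul : ∀ (r : ℝ) (A : Matrix (Fin n) (Fin n) ℂ), A.IsHermitian →
      Λ (r • A) = r • Λ A)
    (hbij : Set.BijOn Λ {A | A.IsHermitian} {A | A.IsHermitian})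
    (hrank : ∀ A : Matrix (Fin n) (Fin n) ℂ, A.IsHermitian → (Λ A).rank = A.rank) :
    ∃ (ε : ℝ) (X : Matrix (Fin n) (Fin n) ℂ), (ε = 1 ∨ ε = -1) ∧ IsUnit X ∧
      ((∀ A : Matrix (Fin n) (Fin n) ℂ, A.IsHermitian → Λ A = ε • (X * A * Xᴴ)) ∨
       (∀ A : Matrix (Fin n) (Fin n) ℂ, A.IsHermitian → Λ A = ε • (X * Aᵀ * Xᴴ))) := by
  have h : RankPres.Lin Λ := ⟨hherm, hadd, hsmul⟩
  have hform : ∀ v : Fin n → ℂ, v ≠ 0 → ∃ w : Fin n → ℂ, w ≠ 0 ∧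
      (Λ (RankPres.out v) = RankPres.out w ∨ Λ (RankPres.out v) = (-1 : ℝ) • RankPres.out w) := by
    intro v hv
    apply RankPres.rank_one_form (hherm _ (RankPres.out_herm v))
    rw [hrank _ (RankPres.out_herm v), RankPres.out_rank hv]
  have hout0 : RankPres.out (0 : Fin n → ℂ) = 0 := by
    ext i j; simp [RankPres.out]
  have htr : ∀ v : Fin n → ℂ, v ≠ 0 → (trace (Λ (RankPres.out v))).re ≠ 0 := by
    intro v hv
    obtain ⟨w, hw, hh | hh⟩ := hform v hv
    · rw [hh]; exact (RankPres.out_trace_pos hw).ne'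
    · rw [hh]; simpa using (RankPres.out_trace_pos hw).ne'
  have hr1 : (Λ 1).rank = n := by
    rw [hrank 1 isHermitian_one]; simp
  by_cases hpos : ∃ v, 0 < (trace (Λ (RankPres.out v))).re
  · obtain ⟨v0, hv0⟩ := hpos
    obtain ⟨X, hX, hc⟩ := RankPres.pos_case hn h (by
      intro v
      by_cases hv : v = 0
      · exact ⟨0, by rw [hv, hout0, h.zero]⟩
      · obtain ⟨w, hw, hh | hh⟩ := hform v hv
        · exact ⟨w, hh⟩
        · exfalso
          refine RankPres.trace_no_mix h htr v0 v hv0 ?_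
          rw [hh]; simpa using RankPres.out_trace_pos hw) hr1
    refine ⟨1, X, Or.inl rfl, hX, ?_⟩
    simpa only [one_smul] using hc
  · have h' : RankPres.Lin (fun A => (-1 : ℝ) • Λ A) := by
      refine ⟨fun A hA => RankPres.smul_herm _ (hherm A hA), ?_, ?_⟩
      · intro A B hA hB
        simp only [hadd A B hA hB, smul_add]
      · intro r A hA
        simp only [hsmul r A hA]
        rw [smul_comm]
    obtain ⟨X, hX, hc⟩ := RankPres.pos_case hn h' (by
      intro v
      by_cases hv : v = 0
      · exact ⟨0, by simp only [hv, hout0, h.zero, smul_zero]⟩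
      · obtain ⟨w, hw, hh | hh⟩ := hform v hv
        · exact absurd ⟨v, by rw [hh]; exact RankPres.out_trace_pos hw⟩ hpos
        · exact ⟨w, by simp [hh]⟩) (by
      have e : (-1 : ℝ) • Λ 1 = Λ ((-1 : ℝ) • 1) := (hsmul _ _ isHermitian_one).symm
      simp only [e]
      rw [hrank _ (RankPres.smul_herm _ isHermitian_one)]
      apply (Matrix.rank_of_isUnit _ _).trans (by simp)
      simp)
    refine ⟨-1, X, Or.inr rfl, hX, ?_⟩
    rcases hc with hc | hc
    · left; intro A hA; rw [← hc A hA]; simp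
    · right; intro A hA; rw [← hc A hA]; simp
end

section
/- Let Λ : H_n(ℂ) → H_n(ℂ) be an invertible ℝ-linear map on Hermitian matrices that preserves the multiset of eigenvalues of every Hermitian matrix. Then there exists a unitary U such that either Λ(A) = U A U† for all A, or Λ(A) = U Aᵀ U† for all A. -/
open Matrix
open scoped ComplexStarModule

lemma aux_prime {n : ℕ} (u v : Matrix (Fin n) (Fin n) ℂ)
    (h : ∀ s, u * s * v + v * s * u = 0) : u = 0 ∨ v = 0 := by
  have key : ∀ i j k l, u i j * v k l + v i j * u k l = 0 := by
    intro i j k l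
    have := congrFun (congrFun (h (single j k 1)) i) l
    simpa [Matrix.mul_apply, single_apply, Finset.sum_ite_eq, ite_and] using this
  by_cases hu : u = 0
  · exact Or.inl hu
  · right
    have : ∃ i j, u i j ≠ 0 := by
      by_contra! hc
      exact hu (by ext i j; simpa using hc i j)
    obtain ⟨i, j, hij⟩ := this
    have h1 : v i j = 0 := by
      have := key i j i j
      have h2 : u i j * v i j = 0 := by linear_combination this / 2
      exact (mul_eq_zero.mp h2).resolve_left hij
    ext k l
    have := key i j k l
    rw [h1, zero_mul, add_zero] at this
    exact (mul_eq_zero.mp this).resolve_left hij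

lemma aux_jordan {n : ℕ}
    (φ : Matrix (Fin n) (Fin n) ℂ →ₗ[ℂ] Matrix (Fin n) (Fin n) ℂ)
    (hsq : ∀ x, φ (x * x) = φ x * φ x) (hs : Function.Surjective φ) :
    (∀ a b, φ (a * b) = φ a * φ b) ∨ (∀ a b, φ (a * b) = φ b * φ a) := by
  have hj : ∀ a b, φ (a * b) + φ (b * a) = φ a * φ b + φ b * φ a := by
    intro a b
    have h := hsq (a + b)
    have e : (a + b) * (a + b) = a * a + b * b + (a * b + b * a) := by noncomm_ring
    rw [e, map_add, map_add, map_add, hsq, hsq, map_add] at h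
    have e2 : (φ a + φ b) * (φ a + φ b)
      = φ a * φ a + φ b * φ b + (φ a * φ b + φ b * φ a) := by noncomm_ring
    rw [e2] at h
    exact add_left_cancel h
  have haba : ∀ a b, φ (a * b * a) = φ a * φ b * φ a := by
    intro a b
    have h1 := hj a (a * b + b * a)
    have h2 := hj (a * a) b
    have e : a * (a * b + b * a) = a * a * b + a * b * a := by noncomm_ring
    have e' : (a * b + b * a) * a = a * b * a + b * (a * a) := by noncomm_ring
    rw [e, e', map_add, map_add, map_add, hj a b] at h1
    rw [hsq] at h2
    have h3 : (2 : ℂ) • φ (a * b * a) = (2 : ℂ) • (φ a * φ b * φ a) := by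
      rw [two_smul, two_smul]
      calc φ (a * b * a) + φ (a * b * a) = (φ (a * a * b) + φ (a * b * a) + (φ (a * b * a) + φ (b * (a * a)))) - (φ (a * a * b) + φ (b * (a * a))) := by abel
        _ = _ := by rw [h1, h2]; noncomm_ring
    exact smul_right_injective _ (two_ne_zero) h3
  have habc : ∀ a b c, φ (a * b * c) + φ (c * b * a) = φ a * φ b * φ c + φ c * φ b * φ a := by
    intro a b c
    have h := haba (a + c) b
    have e : (a + c) * b * (a + c) = a * b * a + c * b * c + (a * b * c + c * b * a) := by
      noncomm_ring
    rw [e, map_add, map_add, map_add, haba, haba, map_add] at h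
    have e2 : (φ a + φ c) * φ b * (φ a + φ c) = φ a * φ b * φ a + φ c * φ b * φ c +
      (φ a * φ b * φ c + φ c * φ b * φ a) := by noncomm_ring
    rw [e2] at h
    exact add_left_cancel h
  have hor : ∀ a b, φ (a * b) = φ a * φ b ∨ φ (a * b) = φ b * φ a := by
    intro a b
    have := aux_prime (φ (a * b) - φ a * φ b) (φ (a * b) - φ b * φ a) (by
      intro s
      obtain ⟨x, rfl⟩ := hs s
      have h1 := habc (a * b) x (b * a)
      have h2 := haba a (b * x * b)
      have h3 := haba b (a * x * a)
      rw [haba b x] at h2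
      rw [haba a x] at h3
      have e1 : a * b * x * (b * a) = a * (b * x * b) * a := by noncomm_ring
      have e2 : b * a * x * (a * b) = b * (a * x * a) * b := by noncomm_ring
      have e3 : φ (b * a) = φ a * φ b + φ b * φ a - φ (a * b) := by
        rw [← hj a b]; abel
      rw [e1, e2, h2, h3, e3] at h1
      rw [← sub_eq_zero] at h1
      rw [← h1]
      noncomm_ring)
    simpa [sub_eq_zero] using this
  have h2 : ∀ a, (∀ b, φ (a * b) = φ a * φ b) ∨ (∀ b, φ (a * b) = φ b * φ a) := by
    intro a
    by_contra! hc
    obtain ⟨⟨b, hb⟩, c, hcc⟩ := hc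
    have hb' := (hor a b).resolve_left hb
    have hc' := (hor a c).resolve_right hcc
    rcases hor a (b + c) with h | h
    · rw [mul_add, map_add, map_add, mul_add, hc'] at h
      exact hb (add_right_cancel h)
    · rw [mul_add, map_add, map_add, add_mul, hb'] at h
      exact hcc (add_left_cancel h)
  by_contra! hc
  obtain ⟨⟨a, b, hab⟩, c, d, hcd⟩ := hc
  have ha := (h2 a).resolve_left (fun h => hab (h b))
  have hc := (h2 c).resolve_right (fun h => hcd (h d))
  rcases h2 (a + c) with h | h
  · have := h b
    rw [add_mul, map_add, map_add, add_mul, hc b] at this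
    exact hab (add_right_cancel this)
  · have := h d
    rw [add_mul, map_add, map_add, mul_add, ha d] at this
    exact hcd (add_left_cancel this)

lemma aux_inner {n : ℕ} (hn : 0 < n)
    (φ : Matrix (Fin n) (Fin n) ℂ →ₗ[ℂ] Matrix (Fin n) (Fin n) ℂ)
    (hm : ∀ a b, φ (a * b) = φ a * φ b) (hs : Function.Surjective φ)
    (hstar : ∀ a, φ aᴴ = (φ a)ᴴ) :
    ∃ U ∈ Matrix.unitaryGroup (Fin n) ℂ, ∀ A, φ A = U * A * Uᴴ := by
  have hi : Function.Injective φ := LinearMap.injective_iff_surjective.mpr hs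
  let z : Fin n := ⟨0, hn⟩
  set P := φ (single z z 1) with hP
  have hP0 : P ≠ 0 := by
    intro h
    have h1 : single z z (1:ℂ) = 0 := hi (by rw [← hP, h, map_zero])
    have := congrFun (congrFun h1 z) z
    simp at this
  obtain ⟨i₀, k, hk⟩ : ∃ i k, P i k ≠ 0 := by
    by_contra! hc
    exact hP0 (by ext i j; simpa using hc i j)
  set c : ℝ := ∑ i, ‖P i k‖ ^ 2 with hc
  have hcpos : 0 < c :=
    Finset.sum_pos' (fun i _ => by positivity) ⟨i₀, Finset.mem_univ _, by positivity⟩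
  have hPP : Pᴴ * P = P := by
    rw [hP, ← hstar, ← hm]; simp
  have hPk : P k k = (c : ℂ) := by
    conv_lhs => rw [← hPP]
    rw [Matrix.mul_apply, hc]
    push_cast
    refine Finset.sum_congr rfl fun i _ => ?_
    rw [conjTranspose_apply, Complex.star_def, Complex.conj_mul']
  let V : Matrix (Fin n) (Fin n) ℂ := of fun i j => φ (single j z 1) i k
  have hVV : Vᴴ * V = (c : ℂ) • 1 := by
    ext j l
    have : (Vᴴ * V) j l = ((φ (single j z 1))ᴴ * φ (single l z 1)) k k := by
      simp [Matrix.mul_apply, V]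
    rw [this, ← hstar, ← hm]
    by_cases hjl : j = l
    · subst hjl
      simp [← hP, hPk]
    · simp [hjl]
  have hAV : ∀ A, φ A * V = V * A := by
    intro A
    ext i j
    have h1 : (φ A * V) i j = (φ A * φ (single j z 1)) i k := by
      simp [Matrix.mul_apply, V]
    have h2 : A * single j z 1 = ∑ l, A l j • single l z (1:ℂ) := by
      ext p q
      simp [Matrix.mul_apply, single_apply, Matrix.sum_apply, ite_and]
    rw [h1, ← hm, h2, map_sum, Matrix.sum_apply, Matrix.mul_apply]
    refine Finset.sum_congr rfl fun l _ => ?_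
    rw [map_smul]
    simp [V, mul_comm]
  let U : Matrix (Fin n) (Fin n) ℂ := ((Real.sqrt c)⁻¹ : ℝ) • V
  have hUU : Uᴴ * U = 1 := by
    simp only [U, conjTranspose_smul, smul_mul_assoc, mul_smul_comm, hVV]
    ext i j
    simp only [Matrix.smul_apply, Complex.real_smul, smul_eq_mul, star_trivial]
    rw [← mul_assoc, ← mul_assoc, ← Complex.ofReal_mul, ← Complex.ofReal_mul, ← mul_inv,
      Real.mul_self_sqrt hcpos.le, inv_mul_cancel₀ hcpos.ne']
    simp
  have hUU' : U * Uᴴ = 1 := mul_eq_one_comm.mp hUU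
  refine ⟨U, Matrix.mem_unitaryGroup_iff.mpr hUU', fun A => ?_⟩
  have : φ A * U = U * A := by
    simp only [U, smul_mul_assoc, mul_smul_comm, hAV]
  rw [← this, mul_assoc, hUU', mul_one]

lemma aux_trace_pow {n : ℕ} {A B : Matrix (Fin n) (Fin n) ℂ} (hA : A.IsHermitian)
    (hB : B.IsHermitian)
    (h : Finset.univ.val.map hA.eigenvalues = Finset.univ.val.map hB.eigenvalues) (m : ℕ) :
    (A ^ m).trace = (B ^ m).trace := by
  have key : ∀ {C : Matrix (Fin n) (Fin n) ℂ} (hC : C.IsHermitian),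
      (C ^ m).trace = ((Finset.univ.val.map hC.eigenvalues).map
        (fun x : ℝ => (x : ℂ) ^ m)).sum := by
    intro C hC
    conv_lhs => rw [hC.spectral_theorem, ← map_pow, Unitary.conjStarAlgAut_apply,
      Matrix.trace_mul_comm, ← mul_assoc]
    rw [Multiset.map_map]
    simp only [Matrix.diagonal_pow, Matrix.trace_diagonal, Unitary.coe_star_mul_self, one_mul]
    rfl
  rw [key hA, key hB, h]

open scoped ComplexOrder in
lemma aux_tr0 {n : ℕ} {D : Matrix (Fin n) (Fin n) ℂ} (hD : D.IsHermitian)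
    (h : (D * D).trace = 0) : D = 0 := by
  rw [← Matrix.trace_conjTranspose_mul_self_eq_zero_iff, hD.eq, h]

lemma aux_tr3 {n : ℕ} (A B : Matrix (Fin n) (Fin n) ℂ) :
    ((A + B) ^ 3).trace = (A ^ 3).trace + 3 * (A * A * B).trace + 3 * (A * B * B).trace
      + (B ^ 3).trace := by
  have e : (A + B) ^ 3 = A ^ 3 + (A * A * B + A * (B * A) + B * (A * A)) +
      (A * B * B + B * A * B + B * (B * A)) + B ^ 3 := by noncomm_ring
  have h1 : (A * (B * A)).trace = (A * A * B).trace := by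
    rw [← mul_assoc, Matrix.trace_mul_comm, mul_assoc]
  have h2 : (B * (A * A)).trace = (A * A * B).trace := Matrix.trace_mul_comm _ _
  have h3 : (B * A * B).trace = (A * B * B).trace := by
    rw [mul_assoc, Matrix.trace_mul_comm]
  have h4 : (B * (B * A)).trace = (A * B * B).trace := by
    rw [← mul_assoc, Matrix.trace_mul_comm, mul_assoc]
  rw [e]
  simp only [Matrix.trace_add, h1, h2, h3, h4]
  ring

lemma aux_tr2 {n : ℕ} (A B : Matrix (Fin n) (Fin n) ℂ) :
    ((A + B) ^ 2).trace = (A ^ 2).trace + 2 * (A * B).trace + (B ^ 2).trace := by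
  have e : (A + B) ^ 2 = A ^ 2 + (A * B + B * A) + B ^ 2 := by noncomm_ring
  rw [e]
  simp only [Matrix.trace_add, Matrix.trace_mul_comm B A]
  ring

/-- An invertible ℝ-linear map `Λ` on `n×n` Hermitian matrices that
preserves the multiset of eigenvalues of every Hermitian matrix is of the form
`Λ(A) = U A U†` or `Λ(A) = U Aᵀ U†` for some unitary `U`. -/
theorem eigenvalue_preserving_maps_on_hermitian_matrices
    (n : ℕ) (hn : 0 < n)
    (Λ : Matrix (Fin n) (Fin n) ℂ → Matrix (Fin n) (Fin n) ℂ)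
    (hherm : ∀ A : Matrix (Fin n) (Fin n) ℂ, A.IsHermitian → (Λ A).IsHermitian)
    (hadd : ∀ A B : Matrix (Fin n) (Fin n) ℂ, A.IsHermitian → B.IsHermitian →
      Λ (A + B) = Λ A + Λ B)
    (hsmul : ∀ (r : ℝ) (A : Matrix (Fin n) (Fin n) ℂ), A.IsHermitian →
      Λ (r • A) = r • Λ A)
    (hbij : Set.BijOn Λ {A | A.IsHermitian} {A | A.IsHermitian})
    (heig : ∀ (A : Matrix (Fin n) (Fin n) ℂ) (hA : A.IsHermitian),
      Finset.univ.val.map ((hherm A hA).eigenvalues)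
        = Finset.univ.val.map hA.eigenvalues) :
    ∃ U : Matrix (Fin n) (Fin n) ℂ, U ∈ Matrix.unitaryGroup (Fin n) ℂ ∧
      ((∀ A : Matrix (Fin n) (Fin n) ℂ, A.IsHermitian → Λ A = U * A * Uᴴ) ∨
       (∀ A : Matrix (Fin n) (Fin n) ℂ, A.IsHermitian → Λ A = U * Aᵀ * Uᴴ)) := by
  have hneg : ∀ A, A.IsHermitian → Λ (-A) = -Λ A := by
    intro A hA
    have := hsmul (-1) A hA
    simpa using this
  have htr : ∀ A, A.IsHermitian → ∀ m : ℕ, (Λ A ^ m).trace = (A ^ m).trace :=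
    fun A hA m => aux_trace_pow (hherm A hA) hA (heig A hA) m
  have h2 : ∀ A B, A.IsHermitian → B.IsHermitian → (Λ A * Λ B).trace = (A * B).trace := by
    intro A B hA hB
    have h := htr (A + B) (hA.add hB) 2
    rw [hadd A B hA hB, aux_tr2, aux_tr2, htr A hA, htr B hB] at h
    linear_combination h / 2
  have h3 : ∀ A B, A.IsHermitian → B.IsHermitian →
      (Λ A * Λ A * Λ B).trace = (A * A * B).trace := by
    intro A B hA hB
    have h := htr (A + B) (hA.add hB) 3
    have h' := htr (A + -B) (hA.add hB.neg) 3
    have hB3 := htr (-B) hB.neg 3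
    rw [hadd A B hA hB, aux_tr3, aux_tr3, htr A hA, htr B hB] at h
    rw [hadd A _ hA hB.neg, aux_tr3, aux_tr3, htr A hA, hB3, hneg B hB] at h'
    simp only [mul_neg, neg_mul, neg_neg, Matrix.trace_neg] at h'
    linear_combination (h - h') / 6
  have hsqΛ : ∀ A, A.IsHermitian → Λ (A * A) = Λ A * Λ A := by
    intro A hA
    have hAA : (A * A).IsHermitian := by
      rw [Matrix.IsHermitian, Matrix.conjTranspose_mul, hA.eq]
    have hLL : (Λ A * Λ A).IsHermitian := by
      rw [Matrix.IsHermitian, Matrix.conjTranspose_mul, (hherm A hA).eq]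
    have hD : (Λ (A * A) - Λ A * Λ A).IsHermitian := (hherm _ hAA).sub hLL
    obtain ⟨B, hB, hBD⟩ := hbij.surjOn hD
    refine sub_eq_zero.mp (aux_tr0 hD ?_)
    conv_lhs => enter [1, 2]; rw [← hBD]
    rw [sub_mul, Matrix.trace_sub, h2 _ _ hAA hB, h3 _ _ hA hB, sub_self]
  have hjΛ : ∀ A B, A.IsHermitian → B.IsHermitian →
      Λ (A * B + B * A) = Λ A * Λ B + Λ B * Λ A := by
    intro A B hA hB
    have hAA : (A * A).IsHermitian := by
      rw [Matrix.IsHermitian, Matrix.conjTranspose_mul, hA.eq]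
    have hBB : (B * B).IsHermitian := by
      rw [Matrix.IsHermitian, Matrix.conjTranspose_mul, hB.eq]
    have hAB : (A * B + B * A).IsHermitian := by
      rw [Matrix.IsHermitian, Matrix.conjTranspose_add, Matrix.conjTranspose_mul,
        Matrix.conjTranspose_mul, hA.eq, hB.eq, add_comm]
    have h := hsqΛ (A + B) (hA.add hB)
    have e : (A + B) * (A + B) = (A * A + B * B) + (A * B + B * A) := by noncomm_ring
    rw [e, hadd _ _ (hAA.add hBB) hAB, hadd _ _ hAA hBB, hadd _ _ hA hB, hsqΛ _ hA, hsqΛ _ hB] at h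
    have e2 : (Λ A + Λ B) * (Λ A + Λ B) = (Λ A * Λ A + Λ B * Λ B) + (Λ A * Λ B + Λ B * Λ A) := by
      noncomm_ring
    rw [e2] at h
    exact add_left_cancel h
  have hre : ∀ X : Matrix (Fin n) (Fin n) ℂ, (ℜ X : Matrix (Fin n) (Fin n) ℂ).IsHermitian :=
    fun X => (ℜ X).2
  have him : ∀ X : Matrix (Fin n) (Fin n) ℂ, (ℑ X : Matrix (Fin n) (Fin n) ℂ).IsHermitian :=
    fun X => (ℑ X).2
  have hsm : ∀ (r : ℝ) (A : Matrix (Fin n) (Fin n) ℂ), A.IsHermitian → (r • A).IsHermitian := by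
    intro r A hA
    rw [Matrix.IsHermitian, Matrix.conjTranspose_smul, hA.eq, star_trivial]
  let φ : Matrix (Fin n) (Fin n) ℂ →ₗ[ℂ] Matrix (Fin n) (Fin n) ℂ :=
    { toFun := fun X => Λ (ℜ X) + Complex.I • Λ (ℑ X)
      map_add' := by
        intro X Y
        simp only [map_add, AddSubgroup.coe_add]
        rw [hadd _ _ (hre X) (hre Y), hadd _ _ (him X) (him Y), smul_add]
        abel
      map_smul' := by
        intro c X
        simp only [realPart_smul, imaginaryPart_smul, RingHom.id_apply, AddSubgroup.coe_add,
          AddSubgroup.coe_sub, selfAdjoint.val_smul]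
        rw [sub_eq_add_neg, hadd _ _ (hsm _ _ (hre X)) (hsm _ _ (him X)).neg,
          hneg _ (hsm _ _ (him X)), hadd _ _ (hsm _ _ (him X)) (hsm _ _ (hre X)),
          hsmul _ _ (hre X), hsmul _ _ (him X), hsmul _ _ (hre X), hsmul _ _ (him X)]
        ext i j
        simp only [Matrix.add_apply, Matrix.neg_apply, Matrix.smul_apply, Complex.real_smul,
          smul_eq_mul]
        conv_rhs => rw [← Complex.re_add_im c]
        linear_combination (-(c.im : ℂ) * Λ (ℑ X) i j) * Complex.I_mul_I }
  have hφ : ∀ X, φ X = Λ (ℜ X) + Complex.I • Λ (ℑ X) := fun X => rfl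
  have hφΛ : ∀ A, A.IsHermitian → φ A = Λ A := by
    intro A hA
    have hA' : IsSelfAdjoint A := hA
    have h0 : Λ 0 = 0 := by simpa using hsmul 0 0 Matrix.isHermitian_zero
    rw [hφ, hA'.coe_realPart, hA'.imaginaryPart]
    simp [h0]
  have hstar : ∀ a, φ aᴴ = (φ a)ᴴ := by
    intro a
    have e : aᴴ = (ℜ a : Matrix (Fin n) (Fin n) ℂ) - Complex.I • (ℑ a : Matrix (Fin n) (Fin n) ℂ) := by
      conv_lhs => rw [← realPart_add_I_smul_imaginaryPart a]
      rw [Matrix.conjTranspose_add, Matrix.conjTranspose_smul, (hre a).eq, (him a).eq]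
      simp [sub_eq_add_neg]
    rw [e, map_sub, map_smul, hφΛ _ (hre a), hφΛ _ (him a), hφ, Matrix.conjTranspose_add,
      Matrix.conjTranspose_smul, (hherm _ (hre a)).eq, (hherm _ (him a)).eq]
    simp [sub_eq_add_neg]
  have hs : Function.Surjective φ := by
    intro Y
    obtain ⟨A, hA, hAY⟩ := hbij.surjOn (hre Y)
    obtain ⟨B, hB, hBY⟩ := hbij.surjOn (him Y)
    refine ⟨A + Complex.I • B, ?_⟩
    rw [map_add, map_smul, hφΛ A hA, hφΛ B hB, hAY, hBY, realPart_add_I_smul_imaginaryPart]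
  have hsq : ∀ x, φ (x * x) = φ x * φ x := by
    intro x
    have key : ∀ A B : Matrix (Fin n) (Fin n) ℂ, (A + Complex.I • B) * (A + Complex.I • B)
        = A * A - B * B + Complex.I • (A * B + B * A) := by
      intro A B
      simp only [add_mul, mul_add, smul_mul_assoc, mul_smul_comm, smul_smul, Complex.I_mul_I,
        smul_add, neg_smul, one_smul]
      abel
    have hA := hre x
    have hB := him x
    have hAA : ((ℜ x : Matrix (Fin n) (Fin n) ℂ) * (ℜ x : Matrix (Fin n) (Fin n) ℂ)).IsHermitian := by
      rw [Matrix.IsHermitian, Matrix.conjTranspose_mul, hA.eq]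
    have hBB : ((ℑ x : Matrix (Fin n) (Fin n) ℂ) * (ℑ x : Matrix (Fin n) (Fin n) ℂ)).IsHermitian := by
      rw [Matrix.IsHermitian, Matrix.conjTranspose_mul, hB.eq]
    have hAB : ((ℜ x : Matrix (Fin n) (Fin n) ℂ) * (ℑ x : Matrix (Fin n) (Fin n) ℂ) +
        (ℑ x : Matrix (Fin n) (Fin n) ℂ) * (ℜ x : Matrix (Fin n) (Fin n) ℂ)).IsHermitian := by
      rw [Matrix.IsHermitian, Matrix.conjTranspose_add, Matrix.conjTranspose_mul,
        Matrix.conjTranspose_mul, hA.eq, hB.eq, add_comm]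
    rw [hφ x, key, ← hsqΛ _ hA, ← hsqΛ _ hB, ← hjΛ _ _ hA hB]
    conv_lhs => rw [← realPart_add_I_smul_imaginaryPart x, key]
    rw [map_add, map_sub, map_smul, hφΛ _ hAA, hφΛ _ hBB, hφΛ _ hAB]
  rcases aux_jordan φ hsq hs with h | h
  · obtain ⟨U, hU, hUA⟩ := aux_inner hn φ h hs hstar
    exact ⟨U, hU, Or.inl fun A hA => by rw [← hφΛ A hA, hUA]⟩
  · let ψ : Matrix (Fin n) (Fin n) ℂ →ₗ[ℂ] Matrix (Fin n) (Fin n) ℂ :=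
      φ ∘ₗ (Matrix.transposeLinearEquiv (Fin n) (Fin n) ℂ ℂ).toLinearMap
    have hψ : ∀ A, ψ A = φ Aᵀ := fun A => rfl
    obtain ⟨U, hU, hUA⟩ := aux_inner hn ψ
      (fun a b => by rw [hψ, hψ, hψ, Matrix.transpose_mul, h])
      (fun Y => by
        obtain ⟨X, rfl⟩ := hs Y
        exact ⟨Xᵀ, by rw [hψ, Matrix.transpose_transpose]⟩)
      (fun a => by
        rw [hψ, hψ, ← hstar]
        rfl)
    exact ⟨U, hU, Or.inr fun A hA => by
      rw [← hφΛ A hA, ← hUA, hψ, Matrix.transpose_transpose]⟩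
end
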